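/- Let F be a locally finite simple graph that is acyclic, such that every connected component of F has infinitely many vertices and no connected component of F contains two disjoint rays (i.e., every component is a one-ended infinite tree). Then for every finite set C of vertices, the set C̃ = { v ∈ V(F) : every ray of F whose image contains v has image meeting C } is finite, and C ⊆ C̃. -/

import Mathlib

/-- A ray in a graph: an injective map `r : ℕ → V` with consecutive vertices adjacent. -/
def SimpleGraph.IsRay {V : Type*} (G : SimpleGraph V) (r : ℕ → V) : Prop :=
  Function.Injective r ∧ ∀ n : ℕ, G.Adj (r n) (r (n + 1))

/-- **Kőnig's lemma**: an infinite set `S v` that keeps being covered, up to the current point, by the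
sets `S z` over finitely many successors `z` yields an infinite chain of successors. -/
theorem exists_seq_of_infinite_of_finite_branching {V : Type*} (S : V → Set V) (R : V → V → Prop)
    (hfin : ∀ x, {z | R x z}.Finite)
    (hcov : ∀ x, ∀ y ∈ S x, y ≠ x → ∃ z, R x z ∧ y ∈ S z) (v : V) (hv : (S v).Infinite) :
    ∃ r : ℕ → V, r 0 = v ∧ ∀ n, R (r n) (r (n + 1)) := by
  have step : ∀ x : {x // (S x).Infinite}, ∃ z : {x // (S x).Infinite}, R x z := by
    rintro ⟨x, hx⟩
    by_contra! h
    refine hx (((Set.finite_singleton x).union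
      ((hfin x).biUnion (t := S) fun z hz => ?_)).subset fun y hy => ?_)
    · by_contra hz'
      exact h ⟨z, hz'⟩ hz
    · by_cases hyx : y = x
      · exact Or.inl hyx
      · obtain ⟨z, hz, hyz⟩ := hcov x y hy hyx
        exact Or.inr (Set.mem_biUnion (x := z) hz hyz)
  choose f hf using step
  refine ⟨fun n => (f^[n] ⟨v, hv⟩ : {x // (S x).Infinite}), rfl, fun n => ?_⟩
  simp only [Function.iterate_succ_apply']
  exact hf _

namespace SimpleGraph

variable {V : Type*} {G : SimpleGraph V}

theorem IsRay.shift {r : ℕ → V} (hr : G.IsRay r) (k : ℕ) : G.IsRay fun n => r (k + n) :=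
  ⟨fun _ _ h => Nat.add_left_cancel (hr.1 h), fun n => hr.2 (k + n)⟩

theorem exists_walk_support_eq_map_range {r : ℕ → V} (hr : ∀ n, G.Adj (r n) (r (n + 1))) (n : ℕ) :
    ∃ p : G.Walk (r 0) (r n), p.support = (List.range (n + 1)).map r := by
  induction n generalizing r with
  | zero => exact ⟨Walk.nil, by simp⟩
  | succ n ih =>
    obtain ⟨p, hp⟩ := ih (r := fun n => r (n + 1)) fun n => hr (n + 1)
    refine ⟨Walk.cons (hr 0) p, ?_⟩
    rw [Walk.support_cons, hp, List.range_succ_eq_map (n := n + 1), List.map_cons, List.map_map]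
    rfl

theorem IsRay.reachable {r : ℕ → V} (hr : G.IsRay r) (n : ℕ) : G.Reachable (r 0) (r n) :=
  (exists_walk_support_eq_map_range hr.2 n).elim fun p _ => p.reachable

/-- In an acyclic graph, two rays from the same vertex agree up to any common vertex. -/
theorem IsAcyclic.isRay_eq_of_le (hG : G.IsAcyclic) {r s : ℕ → V} (hr : G.IsRay r) (hs : G.IsRay s)
    (h0 : r 0 = s 0) {m k : ℕ} (hmk : r m = s k) {i : ℕ} (hi : i ≤ m) : r i = s i := by
  obtain ⟨p, hp⟩ := exists_walk_support_eq_map_range hr.2 m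
  obtain ⟨q, hq⟩ := exists_walk_support_eq_map_range hs.2 k
  have hp' : p.IsPath := (Walk.isPath_def p).2 (hp ▸ List.nodup_range.map hr.1)
  have hq' : (q.copy h0.symm hmk.symm).IsPath :=
    (Walk.isPath_def _).2 (by rw [Walk.support_copy, hq]; exact List.nodup_range.map hs.1)
  have h : p = q.copy h0.symm hmk.symm :=
    congrArg Subtype.val ((hG.subsingleton_path _ _).elim ⟨p, hp'⟩ ⟨_, hq'⟩)
  have hl : (List.range (m + 1)).map r = (List.range (k + 1)).map s := by
    rw [← hp, ← hq, h, Walk.support_copy]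
  have hlen : m = k := by simpa using congrArg List.length hl
  subst hlen
  exact List.map_inj_left.1 hl i (by simpa using Nat.lt_succ_of_le hi)

/-- In a locally finite graph, every vertex of an infinite component starts a ray. -/
theorem exists_isRay_of_infinite_supp [G.LocallyFinite] (v : V)
    (hv : (G.connectedComponentMk v).supp.Infinite) : ∃ r : ℕ → V, r 0 = v ∧ G.IsRay r := by
  obtain ⟨r, h0, hr⟩ := exists_seq_of_infinite_of_finite_branching
    (fun x => {y | G.Reachable v x ∧ G.Reachable v y ∧ G.dist v y = G.dist v x + G.dist x y})
    (fun x z => G.Adj x z ∧ G.dist v z = G.dist v x + 1)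
    (fun x => (Set.toFinite (G.neighborSet x)).subset fun z hz => hz.1)
    (by
      rintro x y ⟨hx, hy, hd⟩ hyx
      obtain ⟨p, hp⟩ := (hx.symm.trans hy).exists_walk_length_eq_dist
      cases p with
      | nil => exact absurd rfl hyx
      | @cons _ z _ hxz q =>
        rw [Walk.length_cons] at hp
        obtain ⟨w, hw⟩ := hx.exists_walk_length_eq_dist
        have h1 := dist_le q
        have h2 := dist_le (w.concat hxz)
        rw [Walk.length_concat] at h2
        have hz : G.Reachable v z := hx.trans hxz.reachable
        obtain ⟨a, ha⟩ := hz.exists_walk_length_eq_dist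
        obtain ⟨b, hb⟩ := q.reachable.exists_walk_length_eq_dist
        have h3 := dist_le (a.append b)
        rw [Walk.length_append] at h3
        exact ⟨z, ⟨hxz, by omega⟩, hz, hy, by omega⟩)
    v (hv.mono fun y hy => by
      have hy' : G.Reachable y v := ConnectedComponent.exact hy
      exact ⟨Reachable.refl v, hy'.symm, by simp⟩)
  have hd : ∀ n, G.dist v (r n) = n := fun n => by
    induction n with
    | zero => simp [h0]
    | succ n ih => rw [(hr n).2, ih]
  exact ⟨r, h0, fun a b hab => by rw [← hd a, ← hd b, hab], fun n => (hr n).1⟩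

/-- In an acyclic graph whose components contain no two disjoint rays, a ray is determined by its
first vertex. -/
theorem IsAcyclic.isRay_unique (hG : G.IsAcyclic)
    (hone : ∀ r s : ℕ → V, G.IsRay r → G.IsRay s → G.Reachable (r 0) (s 0) →
      ¬ Disjoint (Set.range r) (Set.range s))
    {r s : ℕ → V} (hr : G.IsRay r) (hs : G.IsRay s) (h0 : r 0 = s 0) : r = s := by
  funext n
  have hreach : G.Reachable (r n) (s n) := (hr.reachable n).symm.trans (h0 ▸ hs.reachable n)
  obtain ⟨_, ⟨i, rfl⟩, j, hij⟩ :=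
    Set.not_disjoint_iff.1 (hone _ _ (hr.shift n) (hs.shift n) hreach)
  exact hG.isRay_eq_of_le hr hs h0 hij.symm (Nat.le_add_right n i)

/-- If following a map `p` along edges never returns to a vertex already visited and no component
contains two disjoint rays, then every vertex has finitely many `p`-descendants. -/
theorem finite_setOf_iterate_eq [G.LocallyFinite] {p : V → V} (hadj : ∀ v, G.Adj v (p v))
    (hinj : ∀ v, Function.Injective fun n => p^[n] v)
    (hone : ∀ r s : ℕ → V, G.IsRay r → G.IsRay s → G.Reachable (r 0) (s 0) →
      ¬ Disjoint (Set.range r) (Set.range s)) (c : V) : {v | ∃ n, p^[n] v = c}.Finite := by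
  by_contra hinf
  obtain ⟨x, h0, hx⟩ := exists_seq_of_infinite_of_finite_branching
    (fun c => {v | ∃ n, p^[n] v = c}) (fun x z => p z = x)
    (fun x => (Set.toFinite (G.neighborSet x)).subset fun z (hz : p z = x) =>
      (hz ▸ hadj z : G.Adj z x).symm)
    (by
      rintro x y ⟨n, hn⟩ hyx
      cases n with
      | zero => exact absurd hn hyx
      | succ n => exact ⟨p^[n] y, by rw [← hn, Function.iterate_succ_apply'], n, rfl⟩)
    c hinf
  have hback : ∀ k n, p^[k] (x (n + k)) = x n := fun k => by
    induction k with
    | zero => exact fun _ => rfl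
    | succ k ih =>
      intro n
      rw [Function.iterate_succ_apply, ← Nat.add_assoc, hx, ih]
  have hper : ∀ v n, p^[n] v = v → n = 0 := fun v n h => hinj v h
  have hxinj : Function.Injective x := fun a b hab => by
    wlog hle : a ≤ b generalizing a b
    · exact (this b a hab.symm (le_of_not_ge hle)).symm
    obtain ⟨k, rfl⟩ := Nat.exists_eq_add_of_le hle
    have := hper (x (a + k)) k (by rw [hback, hab])
    omega
  have hxray : G.IsRay x := ⟨hxinj, fun n => by
    have h := hadj (x (n + 1))
    rw [hx] at h
    exact h.symm⟩
  have hpray : G.IsRay fun n => p^[n] c :=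
    ⟨hinj c, fun n => by simpa only [Function.iterate_succ_apply'] using hadj (p^[n] c)⟩
  refine hone _ _ (hxray.shift 1) hpray (h0 ▸ (hxray.reachable 1).symm) ?_
  rw [Set.disjoint_left]
  rintro _ ⟨m, rfl⟩ ⟨n, hn⟩
  have h := hback (1 + m) 0
  replace hn : p^[n] c = x (1 + m) := hn
  rw [Nat.zero_add, ← hn, ← Function.iterate_add_apply, h0] at h
  have := hper c _ h
  omega

end SimpleGraph


/-- **Finiteness of the hull `C̃` in a one-ended essential spanning forest.**
If `F` is a locally finite acyclic graph all of whose components are infinite and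
contain no two disjoint rays, then for every finite vertex set `C`, the set
`C̃ = {v : every ray through v meets C}` contains `C` and is finite. -/
theorem oneEnded_forest_hull_finite {V : Type*} (F : SimpleGraph V) [F.LocallyFinite]
    (hacyc : F.IsAcyclic)
    (hinf : ∀ v : V, (F.connectedComponentMk v).supp.Infinite)
    (hone : ∀ r s : ℕ → V, F.IsRay r → F.IsRay s → F.Reachable (r 0) (s 0) →
      ¬ Disjoint (Set.range r) (Set.range s))
    (C : Set V) (hC : C.Finite) :
    C ⊆ {v : V | ∀ r : ℕ → V, F.IsRay r → v ∈ Set.range r → (Set.range r ∩ C).Nonempty} ∧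
      Set.Finite
        {v : V | ∀ r : ℕ → V, F.IsRay r → v ∈ Set.range r → (Set.range r ∩ C).Nonempty} := by
  refine ⟨fun c hc r _ hcr => ⟨c, hcr, hc⟩, ?_⟩
  choose ρ hρ0 hρ using fun v => SimpleGraph.exists_isRay_of_infinite_supp v (hinf v)
  have hshift : ∀ v, ρ (ρ v 1) = fun n => ρ v (1 + n) := fun v =>
    hacyc.isRay_unique hone (hρ _) ((hρ v).shift 1) (hρ0 _)
  have hiter : ∀ n v, (fun v => ρ v 1)^[n] v = ρ v n := fun n => by
    induction n with
    | zero => exact fun v => (hρ0 v).symm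
    | succ n ih =>
      intro v
      rw [Function.iterate_succ_apply, ih, hshift, Nat.add_comm]
  refine (hC.biUnion fun c _ => SimpleGraph.finite_setOf_iterate_eq (G := F)
    (p := fun v => ρ v 1) (fun v => ?_) (fun v => ?_) hone c).subset fun v hv => ?_
  · simpa only [hρ0] using (hρ v).2 0
  · simpa only [hiter] using (hρ v).1
  · obtain ⟨_, ⟨n, rfl⟩, hn⟩ := hv (ρ v) (hρ v) ⟨0, hρ0 v⟩
    exact Set.mem_biUnion hn ⟨n, hiter n v⟩
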